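/- arXiv:0706.2807 — 2 statements merged into one kernel-verified Lean document; each statement's English description precedes it below -/
import Mathlib

section
/- Let q ≥ 3 and a be integers with gcd(q, a) = 1. For a prime p, set α(p; q, a) = φ(q) − 1 if p ≡ a (mod q) and α(p; q, a) = −1 otherwise, where φ is Euler's totient function. Suppose C > 0 is a real number such that (log x)^{1/φ(q)} · ∏_{p ≤ x, p ≡ a (mod q)} (1 − 1/p) tends to C as x → ∞, and suppose the (conditionally convergent) limit D = lim_{x → ∞} ∏_{p ≤ x} (1 − 1/p)^{α(p; q, a)} exists. Then C^{φ(q)} = e^{−γ} · D, where γ is the Euler–Mascheroni constant. -/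
open Filter Topology Finset

/-- The weighted counting function of a generalised Dirichlet series, `∑_{l i ≤ t} w i`. -/
noncomputable def stepSum {ι : Type*} (w l : ι → ℝ) (t : ℝ) : ℝ :=
  ∑' i, if l i ≤ t then w i else 0

section StepSum

variable {ι : Type*} {w l : ι → ℝ} {δ : ℝ}

lemma summable_ite_le (hw : ∀ i, 0 ≤ w i) (hδ : 0 < δ)
    (hs : Summable fun i => w i * Real.exp (-δ * l i)) (t : ℝ) :
    Summable fun i => if l i ≤ t then w i else 0 := by
  refine Summable.of_nonneg_of_le (fun i => by split_ifs <;> simp [hw i]) (fun i => ?_)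
    (hs.mul_left (Real.exp (δ * t)))
  have h0 := hw i
  split_ifs with h
  · have : 1 ≤ Real.exp (δ * t) * Real.exp (-δ * l i) := by
      rw [← Real.exp_add]
      exact Real.one_le_exp (by nlinarith)
    nlinarith
  · positivity

lemma stepSum_nonneg (hw : ∀ i, 0 ≤ w i) (t : ℝ) : 0 ≤ stepSum w l t :=
  tsum_nonneg fun i => by split_ifs <;> simp [hw i]

lemma stepSum_mono (hw : ∀ i, 0 ≤ w i) (hδ : 0 < δ)
    (hs : Summable fun i => w i * Real.exp (-δ * l i)) : Monotone (stepSum w l) := by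
  intro s t hst
  refine Summable.tsum_le_tsum (fun i => ?_) (summable_ite_le hw hδ hs s)
    (summable_ite_le hw hδ hs t)
  have h0 := hw i
  split_ifs <;> first | exact le_rfl | exact h0 | linarith

lemma integrableOn_exp_weight (hδ : 0 < δ) (c : ℝ) :
    MeasureTheory.IntegrableOn (fun t => δ * Real.exp (-δ * t)) (Set.Ioi c) :=
  (integrableOn_exp_mul_Ioi (by linarith) c).const_mul δ

lemma integral_exp_weight (hδ : 0 < δ) (c : ℝ) :
    ∫ t in Set.Ioi c, δ * Real.exp (-δ * t) = Real.exp (-δ * c) := by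
  rw [MeasureTheory.integral_const_mul, integral_exp_mul_Ioi (by linarith)]
  field_simp

/-- The Laplace transform of a step function is the corresponding Dirichlet series. -/
lemma integral_stepSum [Countable ι] (hw : ∀ i, 0 ≤ w i) (hl : ∀ i, 0 ≤ l i) (hδ : 0 < δ)
    (hs : Summable fun i => w i * Real.exp (-δ * l i)) :
    MeasureTheory.IntegrableOn (fun t => δ * Real.exp (-δ * t) * stepSum w l t) (Set.Ioi 0) ∧
      ∫ t in Set.Ioi (0 : ℝ), δ * Real.exp (-δ * t) * stepSum w l t =
        ∑' i, w i * Real.exp (-δ * l i) := by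
  let F : ι → ℝ → ℝ := fun i =>
    (Set.Ici (l i)).indicator fun t => w i * (δ * Real.exp (-δ * t))
  have hF0 : ∀ i t, 0 ≤ F i t := fun i t =>
    Set.indicator_nonneg (fun t _ => mul_nonneg (hw i) (by positivity)) t
  have hFi : ∀ i, MeasureTheory.IntegrableOn (F i) (Set.Ioi 0) := fun i =>
    ((integrableOn_exp_weight hδ 0).const_mul (w i)).indicator measurableSet_Ici
  have hFv : ∀ i, ∫ t in Set.Ioi (0 : ℝ), F i t = w i * Real.exp (-δ * l i) := fun i => by
    have h1 : (Set.Ioi (0 : ℝ) ∩ Set.Ici (l i) : Set ℝ) =ᵐ[MeasureTheory.volume]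
        Set.Ioi (l i) := by
      have h2 : (Set.Ioi (0 : ℝ) ∩ Set.Ici (l i) : Set ℝ) =ᵐ[MeasureTheory.volume]
          (Set.Ioi 0 ∩ Set.Ioi (l i) : Set ℝ) :=
        Filter.EventuallyEq.rfl.inter MeasureTheory.Ioi_ae_eq_Ici.symm
      rwa [Set.Ioi_inter_Ioi, sup_of_le_right (hl i)] at h2
    rw [MeasureTheory.setIntegral_indicator measurableSet_Ici,
      MeasureTheory.setIntegral_congr_set h1, MeasureTheory.integral_const_mul,
      integral_exp_weight hδ]
  have hFs : ∀ t, δ * Real.exp (-δ * t) * stepSum w l t = ∑' i, F i t := fun t => by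
    rw [stepSum, ← tsum_mul_left]
    refine tsum_congr fun i => ?_
    simp only [F, Set.indicator_apply, Set.mem_Ici]
    split_ifs <;> ring
  have hv := MeasureTheory.integral_tsum_of_summable_integral_norm hFi (by
    simpa only [Real.norm_of_nonneg (hF0 _ _), hFv] using hs)
  simp only [hFv, ← hFs] at hv
  refine ⟨?_, hv.symm⟩
  by_cases h0 : ∑' i, w i * Real.exp (-δ * l i) = 0
  · have hw0 : ∀ i, w i = 0 := fun i => by
      have := (hs.hasSum_iff.2 h0)
      rw [hasSum_zero_iff_of_nonneg fun i => mul_nonneg (hw i) (Real.exp_pos _).le] at this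
      simpa [Real.exp_ne_zero] using congrFun this i
    simp [stepSum, hw0]
  · exact MeasureTheory.Integrable.of_integral_ne_zero (hv ▸ h0)

/-- An Abelian comparison principle: an eventual inequality between counting functions passes to
the constant when the corresponding Dirichlet series agree asymptotically at the origin. -/
lemma nonneg_of_stepSum_le {κ : Type*} [Countable ι] [Countable κ] {v m : κ → ℝ} {k : ℝ}
    (hw : ∀ i, 0 ≤ w i) (hl : ∀ i, 0 ≤ l i) (hv : ∀ i, 0 ≤ v i) (hm : ∀ i, 0 ≤ m i)
    (hws : ∀ δ > 0, Summable fun i => w i * Real.exp (-δ * l i))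
    (hvs : ∀ δ > 0, Summable fun i => v i * Real.exp (-δ * m i))
    (hlim : Tendsto (fun δ : ℝ => ∑' i, w i * Real.exp (-δ * l i) -
      ∑' i, v i * Real.exp (-δ * m i)) (𝓝[>] 0) (𝓝 0))
    (hk : ∀ᶠ t in atTop, stepSum w l t ≤ stepSum v m t + k) : 0 ≤ k := by
  obtain ⟨T, hT⟩ := eventually_atTop.1 hk
  set S := max T 0
  set M := stepSum w l S + |k|
  have hM0 : 0 ≤ M := add_nonneg (stepSum_nonneg hw _) (abs_nonneg k)
  have key : ∀ δ > 0, ∑' i, w i * Real.exp (-δ * l i) - ∑' i, v i * Real.exp (-δ * m i) ≤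
      (k + M) - M * Real.exp (-δ * S) := by
    intro δ hδ
    obtain ⟨hwi, hwe⟩ := integral_stepSum hw hl hδ (hws δ hδ)
    obtain ⟨hvi, hve⟩ := integral_stepSum hv hm hδ (hvs δ hδ)
    have hei := integrableOn_exp_weight hδ 0
    have hee := integral_exp_weight hδ 0
    have hii : MeasureTheory.IntegrableOn
        ((Set.Ioi S).indicator fun t => δ * Real.exp (-δ * t)) (Set.Ioi 0) :=
      hei.indicator measurableSet_Ioi
    have hie : ∫ t in Set.Ioi (0 : ℝ), (Set.Ioi S).indicator (fun t => δ * Real.exp (-δ * t)) t =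
        Real.exp (-δ * S) := by
      rw [MeasureTheory.setIntegral_indicator measurableSet_Ioi, Set.Ioi_inter_Ioi,
        sup_of_le_right (le_max_right T 0), integral_exp_weight hδ]
    have hle : ∫ t in Set.Ioi (0 : ℝ), (δ * Real.exp (-δ * t) * stepSum w l t +
          M * (Set.Ioi S).indicator (fun t => δ * Real.exp (-δ * t)) t) ≤
        ∫ t in Set.Ioi (0 : ℝ), (δ * Real.exp (-δ * t) * stepSum v m t +
          (k + M) * (δ * Real.exp (-δ * t))) := by
      refine MeasureTheory.integral_mono (hwi.add (hii.const_mul M))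
        (hvi.add (hei.const_mul (k + M))) fun t => ?_
      have he : 0 ≤ δ * Real.exp (-δ * t) := by positivity
      have hv0 := stepSum_nonneg (l := m) hv t
      simp only [Set.indicator_apply, Set.mem_Ioi]
      split_ifs with h
      · have := hT t ((le_max_left T 0).trans h.le)
        nlinarith
      · have := stepSum_mono hw hδ (hws δ hδ) (not_lt.1 h)
        have h2 := neg_abs_le k
        nlinarith
    rw [MeasureTheory.integral_add hwi (hii.const_mul M),
      MeasureTheory.integral_add hvi (hei.const_mul (k + M)), MeasureTheory.integral_const_mul,
      MeasureTheory.integral_const_mul, hwe, hve, hie, hee] at hle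
    simp only [mul_zero, Real.exp_zero, mul_one] at hle
    linarith
  have hr : Tendsto (fun δ : ℝ => (k + M) - M * Real.exp (-δ * S)) (𝓝[>] 0) (𝓝 k) := by
    have : Continuous fun δ : ℝ => (k + M) - M * Real.exp (-δ * S) := by fun_prop
    simpa using (this.tendsto 0).mono_left nhdsWithin_le_nhds
  exact le_of_tendsto_of_tendsto hlim hr (eventually_mem_nhdsWithin.mono key)

end StepSum

section Weights

/-- The weight `-log (1 - 1/p)` of a prime. -/
noncomputable def primeWeight (p : Nat.Primes) : ℝ := -Real.log (1 - 1 / (p : ℝ))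

lemma abs_neg_log_one_sub_sub_le {u : ℝ} (h0 : 0 ≤ u) (h1 : u ≤ 1 / 2) :
    |-Real.log (1 - u) - u| ≤ 2 * u ^ 2 := by
  have h := Real.abs_log_sub_add_sum_range_le (x := u) (by rw [abs_of_nonneg h0]; linarith) 1
  simp only [sum_range_one, zero_add, pow_one, Nat.cast_zero, div_one, abs_of_nonneg h0,
    one_add_one_eq_two] at h
  rw [← abs_neg, show -(-Real.log (1 - u) - u) = u + Real.log (1 - u) by ring]
  refine h.trans ?_
  rw [div_le_iff₀ (by linarith)]
  nlinarith [mul_nonneg (sq_nonneg u) (by linarith : 0 ≤ 1 - 2 * u)]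

lemma one_div_prime_mem (p : Nat.Primes) : 0 < 1 / (p : ℝ) ∧ 1 / (p : ℝ) ≤ 1 / 2 := by
  have h2 : (2 : ℝ) ≤ (p : ℝ) := by exact_mod_cast p.2.two_le
  exact ⟨by positivity, one_div_le_one_div_of_le two_pos h2⟩

lemma primeWeight_nonneg (p : Nat.Primes) : 0 ≤ primeWeight p := by
  obtain ⟨h0, h1⟩ := one_div_prime_mem p
  exact neg_nonneg.2 (Real.log_nonpos (by linarith) (by linarith))

lemma primeWeight_le (p : Nat.Primes) : primeWeight p ≤ 2 * (1 / (p : ℝ)) := by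
  obtain ⟨h0, h1⟩ := one_div_prime_mem p
  have := (abs_le.1 (abs_neg_log_one_sub_sub_le h0.le h1)).2
  rw [primeWeight]
  nlinarith

lemma exp_neg_mul_log_prime (δ : ℝ) (p : Nat.Primes) :
    1 / (p : ℝ) * Real.exp (-δ * Real.log p) = 1 / (p : ℝ) ^ (1 + δ) := by
  have hp : (0 : ℝ) < (p : ℝ) := by exact_mod_cast p.2.pos
  rw [Real.rpow_def_of_pos hp, one_div, one_div, ← Real.exp_neg, mul_add, neg_add, Real.exp_add,
    mul_one, Real.exp_neg (Real.log _), Real.exp_log hp]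
  ring_nf

lemma summable_primes_rpow {s : ℝ} (hs : 1 < s) :
    Summable fun p : Nat.Primes => 1 / (p : ℝ) ^ s :=
  (Real.summable_one_div_nat_rpow.2 hs).comp_injective Subtype.val_injective

lemma summable_primeWeight {δ : ℝ} (hδ : 0 < δ) :
    Summable fun p : Nat.Primes => primeWeight p * Real.exp (-δ * Real.log p) := by
  refine Summable.of_nonneg_of_le
    (fun p => mul_nonneg (primeWeight_nonneg p) (Real.exp_pos _).le) (fun p => ?_)
    ((summable_primes_rpow (s := 1 + δ) (by linarith)).mul_left 2)
  rw [← exp_neg_mul_log_prime, ← mul_assoc]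
  exact mul_le_mul_of_nonneg_right (primeWeight_le p) (Real.exp_pos _).le

lemma abs_log_sub_primeWeight_le {δ : ℝ} (hδ : 0 < δ) (p : Nat.Primes) :
    |-Real.log (1 - 1 / (p : ℝ) ^ (1 + δ)) - primeWeight p * Real.exp (-δ * Real.log p)| ≤
      4 * (1 / (p : ℝ) ^ (2 : ℝ)) := by
  obtain ⟨h0, h1⟩ := one_div_prime_mem p
  have hp : (1 : ℝ) ≤ (p : ℝ) := by exact_mod_cast p.2.one_le
  rw [← exp_neg_mul_log_prime, primeWeight, Real.rpow_two, ← one_div_pow]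
  set x := 1 / (p : ℝ)
  set y := Real.exp (-δ * Real.log p)
  have hy0 : 0 < y := Real.exp_pos _
  have hy1 : y ≤ 1 := Real.exp_le_one_iff.2 (by nlinarith [Real.log_nonneg hp])
  have hxy : x * y ≤ x := mul_le_of_le_one_right h0.le hy1
  have hxy0 : 0 ≤ x * y := by positivity
  have e1 := abs_le.1 (abs_neg_log_one_sub_sub_le hxy0 (hxy.trans h1))
  have e2 := abs_le.1 (abs_neg_log_one_sub_sub_le h0.le h1)
  have hsq : (x * y) ^ 2 ≤ x ^ 2 := pow_le_pow_left₀ hxy0 hxy 2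
  have hx2 : x ^ 2 * y ≤ x ^ 2 := mul_le_of_le_one_right (sq_nonneg x) hy1
  have e3 := mul_le_mul_of_nonneg_right e2.1 hy0.le
  have e4 := mul_le_mul_of_nonneg_right e2.2 hy0.le
  exact abs_le.2 ⟨by linarith [e1.1], by linarith [e1.2]⟩

lemma tendsto_tsum_log_sub_primeWeight :
    Tendsto (fun δ : ℝ => ∑' p : Nat.Primes, (-Real.log (1 - 1 / (p : ℝ) ^ (1 + δ)) -
      primeWeight p * Real.exp (-δ * Real.log p))) (𝓝[>] 0) (𝓝 0) := by
  have h := tendsto_tsum_of_dominated_convergence (𝓕 := 𝓝[>] (0 : ℝ))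
    (f := fun δ (p : Nat.Primes) => -Real.log (1 - 1 / (p : ℝ) ^ (1 + δ)) -
      primeWeight p * Real.exp (-δ * Real.log p)) (g := fun _ => 0)
    ((summable_primes_rpow one_lt_two).mul_left 4) (fun p => ?_)
    (eventually_mem_nhdsWithin.mono fun δ hδ p => abs_log_sub_primeWeight_le hδ p)
  · simpa using h
  · obtain ⟨h0, h1⟩ := one_div_prime_mem p
    have hc : ContinuousAt (fun δ : ℝ => -Real.log (1 - 1 / (p : ℝ) * Real.exp (-δ * Real.log p)) -
        primeWeight p * Real.exp (-δ * Real.log p)) 0 := by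
      refine ContinuousAt.sub (ContinuousAt.neg (ContinuousAt.log (by fun_prop) ?_)) (by fun_prop)
      simp only [neg_zero, zero_mul, Real.exp_zero, mul_one]
      linarith
    have := hc.tendsto.mono_left (nhdsWithin_le_nhds (s := Set.Ioi 0))
    simpa only [exp_neg_mul_log_prime, neg_zero, zero_mul, Real.exp_zero, mul_one, primeWeight,
      sub_self] using this

lemma summable_neg_log_primes {s : ℝ} (hs : 1 < s) :
    Summable fun p : Nat.Primes => -Real.log (1 - 1 / (p : ℝ) ^ s) := by
  have h := (Summable.of_norm_bounded ((summable_primes_rpow one_lt_two).mul_left 4)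
    (fun p => abs_log_sub_primeWeight_le (sub_pos.2 hs) p)).add
    (summable_primeWeight (sub_pos.2 hs))
  simpa using h

/-- The logarithm of the Euler product of the zeta function on the real half-line `s > 1`. -/
lemma exp_tsum_neg_log_primes {s : ℝ} (hs : 1 < s) :
    Real.exp (∑' p : Nat.Primes, -Real.log (1 - 1 / (p : ℝ) ^ s)) = ∑' n : ℕ, 1 / (n : ℝ) ^ s := by
  let f : ℕ →*₀ ℝ :=
    { toFun := fun n => 1 / (n : ℝ) ^ s
      map_zero' := by simp [Real.zero_rpow (by linarith : s ≠ 0)]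
      map_one' := by simp
      map_mul' := fun m n => by
        simp [Real.mul_rpow (Nat.cast_nonneg m) (Nat.cast_nonneg n), mul_comm] }
  have hf : Summable (‖f ·‖) := (Real.summable_one_div_nat_rpow.2 hs).norm
  have h1 := EulerProduct.eulerProduct_completely_multiplicative_hasProd hf
  have h2 := (summable_neg_log_primes hs).hasSum.rexp
  refine h2.unique (h1.congr_fun fun p => ?_)
  have hp : (1 : ℝ) < (p : ℝ) := by exact_mod_cast p.2.one_lt
  have : 1 / (p : ℝ) ^ s < 1 :=
    (div_lt_one (by positivity)).2 (Real.one_lt_rpow hp (by linarith))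
  simp only [Function.comp_apply]
  rw [Real.exp_neg, Real.exp_log (by linarith)]
  rfl

lemma hasSum_harmonicWeight {δ : ℝ} (hδ : 0 < δ) :
    HasSum (fun n : ℕ => 1 / ((n : ℝ) + 1) * Real.exp (-δ * ((n : ℝ) + 1)))
      (-Real.log (1 - Real.exp (-δ))) := by
  have h := Real.hasSum_pow_div_log_of_abs_lt_one (x := Real.exp (-δ)) (by
    rw [abs_of_pos (Real.exp_pos _)]
    exact Real.exp_lt_one_iff.2 (by linarith))
  convert h using 2 with n
  rw [← Real.exp_nat_mul, Nat.cast_add_one, mul_comm (-δ)]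
  ring

lemma tendsto_one_sub_exp_neg_div :
    Tendsto (fun δ : ℝ => (1 - Real.exp (-δ)) / δ) (𝓝[>] 0) (𝓝 1) := by
  have h : HasDerivAt (fun δ : ℝ => 1 - Real.exp (-δ)) 1 0 := by
    simpa using ((hasDerivAt_neg (0 : ℝ)).exp).const_sub 1
  have := h.tendsto_slope.mono_left (nhdsWithin_mono 0 (fun x (hx : 0 < x) => hx.ne'))
  refine this.congr fun δ => ?_
  simp [slope_def_field]

lemma tendsto_primeSeries_sub_harmonicSeries :
    Tendsto (fun δ : ℝ => ∑' p : Nat.Primes, primeWeight p * Real.exp (-δ * Real.log p) -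
      ∑' n : ℕ, 1 / ((n : ℝ) + 1) * Real.exp (-δ * ((n : ℝ) + 1))) (𝓝[>] 0) (𝓝 0) := by
  have hz : Tendsto (fun δ : ℝ => δ * ∑' n : ℕ, 1 / (n : ℝ) ^ (1 + δ)) (𝓝[>] 0) (𝓝 1) := by
    have hm : Tendsto (fun δ : ℝ => 1 + δ) (𝓝[>] 0) (𝓝[>] 1) := by
      refine tendsto_nhdsWithin_iff.2 ⟨?_, eventually_mem_nhdsWithin.mono fun δ (hδ : 0 < δ) => ?_⟩
      · have : Continuous fun δ : ℝ => 1 + δ := by fun_prop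
        simpa using (this.tendsto 0).mono_left (nhdsWithin_le_nhds (s := Set.Ioi 0))
      · simpa using hδ
    simpa [Function.comp_def] using tendsto_sub_mul_tsum_nat_rpow.comp hm
  have hl := ((hz.log one_ne_zero).add (tendsto_one_sub_exp_neg_div.log one_ne_zero)).sub
    tendsto_tsum_log_sub_primeWeight
  simp only [Real.log_one, add_zero, sub_zero] at hl
  refine hl.congr' (eventually_mem_nhdsWithin.mono fun δ (hδ : 0 < δ) => ?_)
  have hs : 1 < 1 + δ := by linarith
  have he : Real.exp (-δ) < 1 := Real.exp_lt_one_iff.2 (by linarith)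
  simp only
  rw [(hasSum_harmonicWeight hδ).tsum_eq, ← exp_tsum_neg_log_primes hs,
    Real.log_mul hδ.ne' (Real.exp_ne_zero _), Real.log_exp, Real.log_div (by linarith) hδ.ne',
    (summable_neg_log_primes hs).tsum_sub (summable_primeWeight hδ)]
  ring

end Weights

section Mertens

/-- The partial Euler product `∏_{p ≤ x} (1 - 1/p)`. -/
noncomputable def mertensProduct (x : ℝ) : ℝ :=
  ∏ p ∈ (Nat.floor x + 1).primesBelow, (1 - 1 / (p : ℝ))

lemma one_sub_one_div_pos {p : ℕ} (hp : p.Prime) : (0 : ℝ) < 1 - 1 / (p : ℝ) := by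
  have := (one_div_prime_mem ⟨p, hp⟩).2
  simp only at this
  linarith

lemma mertensProduct_pos (x : ℝ) : 0 < mertensProduct x :=
  prod_pos fun _ hp => one_sub_one_div_pos (Nat.prime_of_mem_primesBelow hp)

lemma stepSum_primeWeight (t : ℝ) :
    stepSum primeWeight (fun p => Real.log p) t = -Real.log (mertensProduct (Real.exp t)) := by
  rw [mertensProduct, Real.log_prod fun p hp =>
    (one_sub_one_div_pos (Nat.prime_of_mem_primesBelow hp)).ne', ← sum_neg_distrib]
  have h : stepSum primeWeight (fun p => Real.log p) t = ∑' n : ℕ, {p : ℕ | p.Prime}.indicator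
      (fun n : ℕ => if Real.log n ≤ t then -Real.log (1 - 1 / (n : ℝ)) else 0) n :=
    tsum_subtype {p : ℕ | p.Prime}
      (fun n : ℕ => if Real.log n ≤ t then -Real.log (1 - 1 / (n : ℝ)) else 0)
  have hiff : ∀ n : ℕ, n.Prime → (Real.log n ≤ t ↔ n ∈ (⌊Real.exp t⌋₊ + 1).primesBelow) := by
    intro n hn
    rw [Nat.mem_primesBelow, Nat.lt_add_one_iff, Nat.le_floor_iff (Real.exp_pos t).le,
      Real.log_le_iff_le_exp (by exact_mod_cast hn.pos)]
    simp [hn]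
  rw [h, tsum_eq_sum (s := (⌊Real.exp t⌋₊ + 1).primesBelow)]
  · refine sum_congr rfl fun n hn => ?_
    have hp := Nat.prime_of_mem_primesBelow hn
    rw [Set.indicator_of_mem (by exact hp), if_pos ((hiff n hp).2 hn)]
  · intro n hn
    by_cases hp : n.Prime
    · rw [Set.indicator_of_mem (by exact hp), if_neg (fun h => hn ((hiff n hp).1 h))]
    · exact Set.indicator_of_notMem hp _

lemma stepSum_harmonicWeight {t : ℝ} (ht : 0 ≤ t) :
    stepSum (fun n : ℕ => 1 / ((n : ℝ) + 1)) (fun n => (n : ℝ) + 1) t = harmonic ⌊t⌋₊ := by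
  have hiff : ∀ n : ℕ, ((n : ℝ) + 1 ≤ t ↔ n ∈ range ⌊t⌋₊) := by
    intro n
    rw [mem_range, ← Nat.add_one_le_iff, Nat.le_floor_iff ht, Nat.cast_add_one]
  rw [stepSum, tsum_eq_sum (s := range ⌊t⌋₊) fun n hn => if_neg fun h => hn ((hiff n).1 h),
    harmonic]
  push_cast
  exact sum_congr rfl fun n hn => by rw [if_pos ((hiff n).2 hn), one_div]

lemma tendsto_harmonic_floor_sub_log :
    Tendsto (fun t : ℝ => (harmonic ⌊t⌋₊ : ℝ) - Real.log t) atTop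
      (𝓝 Real.eulerMascheroniConstant) := by
  have h1 := Real.tendsto_harmonic_sub_log.comp (tendsto_nat_floor_atTop (α := ℝ))
  have h2 := (tendsto_nat_floor_div_atTop (R := ℝ)).log one_ne_zero
  rw [Real.log_one] at h2
  have h3 := h1.add h2
  rw [add_zero] at h3
  refine h3.congr' ?_
  filter_upwards [eventually_ge_atTop 1] with t ht
  have hf : (⌊t⌋₊ : ℝ) ≠ 0 := by exact_mod_cast (Nat.floor_pos.2 ht).ne'
  simp only [Function.comp_apply]
  rw [Real.log_div hf (by linarith)]
  ring

lemma log_log_mul_mertensProduct {t : ℝ} (ht : 0 < t) :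
    Real.log (Real.log (Real.exp t) * mertensProduct (Real.exp t)) =
      stepSum (fun n : ℕ => 1 / ((n : ℝ) + 1)) (fun n => (n : ℝ) + 1) t -
        stepSum primeWeight (fun p => Real.log p) t - ((harmonic ⌊t⌋₊ : ℝ) - Real.log t) := by
  rw [stepSum_primeWeight, stepSum_harmonicWeight ht.le, Real.log_exp,
    Real.log_mul ht.ne' (mertensProduct_pos _).ne']
  ring

lemma log_prime_nonneg (p : Nat.Primes) : 0 ≤ Real.log p :=
  Real.log_nonneg (by exact_mod_cast p.2.one_le)

lemma nonneg_of_primeStep_le {k : ℝ}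
    (hk : ∀ᶠ t in atTop, stepSum primeWeight (fun p => Real.log p) t ≤
      stepSum (fun n : ℕ => 1 / ((n : ℝ) + 1)) (fun n => (n : ℝ) + 1) t + k) : 0 ≤ k :=
  nonneg_of_stepSum_le primeWeight_nonneg log_prime_nonneg (fun n => by positivity)
    (fun n => by positivity) (fun _ hδ => summable_primeWeight hδ)
    (fun _ hδ => (hasSum_harmonicWeight hδ).summable) tendsto_primeSeries_sub_harmonicSeries hk

lemma nonneg_of_harmonicStep_le {k : ℝ}
    (hk : ∀ᶠ t in atTop, stepSum (fun n : ℕ => 1 / ((n : ℝ) + 1)) (fun n => (n : ℝ) + 1) t ≤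
      stepSum primeWeight (fun p => Real.log p) t + k) : 0 ≤ k :=
  nonneg_of_stepSum_le (fun n => by positivity) (fun n => by positivity) primeWeight_nonneg
    log_prime_nonneg (fun _ hδ => (hasSum_harmonicWeight hδ).summable)
    (fun _ hδ => summable_primeWeight hδ)
    (by simpa using tendsto_primeSeries_sub_harmonicSeries.neg) hk

lemma not_tendsto_log_mul_mertensProduct_atTop :
    ¬ Tendsto (fun x => Real.log x * mertensProduct x) atTop atTop := by
  intro h
  have hg := (Real.tendsto_log_atTop.comp (h.comp Real.tendsto_exp_atTop)).atTop_add
    tendsto_harmonic_floor_sub_log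
  have : (0 : ℝ) ≤ -1 := nonneg_of_primeStep_le <| by
    filter_upwards [hg.eventually_ge_atTop 1, eventually_gt_atTop 0] with t h1 ht
    simp only [Function.comp_apply, log_log_mul_mertensProduct ht] at h1
    linarith
  linarith

/-- If `log x * ∏_{p ≤ x} (1 - 1/p)` has a positive limit, then the limit is `e^{-γ}`. -/
lemma eq_exp_neg_of_tendsto_log_mul_mertensProduct {L : ℝ} (hL : 0 < L)
    (h : Tendsto (fun x => Real.log x * mertensProduct x) atTop (𝓝 L)) :
    L = Real.exp (-Real.eulerMascheroniConstant) := by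
  have hg := ((h.comp Real.tendsto_exp_atTop).log hL.ne').add tendsto_harmonic_floor_sub_log
  set ℓ := Real.log L + Real.eulerMascheroniConstant
  have hle : ℓ ≤ 0 := le_of_forall_pos_le_add fun ε hε => by
    have : 0 ≤ -(ℓ - ε) := nonneg_of_primeStep_le <| by
      filter_upwards [hg.eventually_const_le (sub_lt_self ℓ hε), eventually_gt_atTop 0] with t h1 ht
      simp only [Function.comp_apply, log_log_mul_mertensProduct ht] at h1
      linarith
    linarith
  have hge : 0 ≤ ℓ := le_of_forall_pos_le_add fun ε hε => nonneg_of_harmonicStep_le <| by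
    filter_upwards [hg.eventually_le_const (lt_add_of_pos_right ℓ hε), eventually_gt_atTop 0]
      with t h1 ht
    simp only [Function.comp_apply, log_log_mul_mertensProduct ht] at h1
    linarith
  rw [← Real.exp_log hL]
  congr 1
  linarith

lemma prod_zpow_mul_mertensProduct (q a : ℕ) (x : ℝ) :
    (∏ p ∈ (Nat.floor x + 1).primesBelow,
        (1 - 1 / (p : ℝ)) ^ (if p % q = a % q then (q.totient : ℤ) - 1 else -1)) *
      mertensProduct x =
    (∏ p ∈ (Nat.floor x + 1).primesBelow.filter (fun p => p % q = a % q),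
      (1 - 1 / (p : ℝ))) ^ q.totient := by
  rw [mertensProduct, ← prod_mul_distrib, ← prod_pow, prod_filter]
  refine prod_congr rfl fun p hp => ?_
  have h0 := (one_sub_one_div_pos (Nat.prime_of_mem_primesBelow hp)).ne'
  split_ifs
  · rw [← zpow_add_one₀ h0, sub_add_cancel, zpow_natCast]
  · rw [zpow_neg_one, inv_mul_cancel₀ h0]

end Mertens

/-- **Mertens product for arithmetic progressions, identity for the constant.**
If `(log x)^{1/φ(q)} ∏_{p ≤ x, p ≡ a (q)} (1 - 1/p) → C > 0` and the conditionally
convergent product `∏_{p ≤ x} (1 - 1/p)^{α(p;q,a)} → D`, where `α(p;q,a) = φ(q) - 1`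
when `p ≡ a (q)` and `-1` otherwise, then `C^{φ(q)} = e^{-γ} D`. -/
theorem mertens_constant_identity (q a : ℕ) (hq : 3 ≤ q) (ha : Nat.Coprime q a)
    (C D : ℝ) (hCpos : 0 < C)
    (hC : Tendsto (fun x : ℝ =>
        Real.log x ^ ((1 : ℝ) / q.totient) *
          ∏ p ∈ (Nat.floor x + 1).primesBelow.filter (fun p => p % q = a % q),
            (1 - 1 / (p : ℝ)))
      atTop (𝓝 C))
    (hD : Tendsto (fun x : ℝ =>
        ∏ p ∈ (Nat.floor x + 1).primesBelow,
          (1 - 1 / (p : ℝ)) ^ (if p % q = a % q then (q.totient : ℤ) - 1 else -1))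
      atTop (𝓝 D)) :
    C ^ q.totient = Real.exp (-Real.eulerMascheroniConstant) * D := by
  have hφ : q.totient ≠ 0 := (Nat.totient_pos.2 (by omega)).ne'
  have hCφ : 0 < C ^ q.totient := pow_pos hCpos _
  set R : ℝ → ℝ := fun x => ∏ p ∈ (Nat.floor x + 1).primesBelow,
    (1 - 1 / (p : ℝ)) ^ (if p % q = a % q then (q.totient : ℤ) - 1 else -1)
  have hRpos : ∀ x, 0 < R x := fun x => prod_pos fun p hp =>
    zpow_pos (one_sub_one_div_pos (Nat.prime_of_mem_primesBelow hp)) _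
  have hD0 : 0 ≤ D := ge_of_tendsto' hD fun x => (hRpos x).le
  have hN : Tendsto (fun x => Real.log x * mertensProduct x * R x) atTop (𝓝 (C ^ q.totient)) := by
    refine (hC.pow q.totient).congr' ?_
    filter_upwards [eventually_ge_atTop 1] with x hx
    rw [mul_pow, ← prod_zpow_mul_mertensProduct, ← Real.rpow_natCast, ← Real.rpow_mul
      (Real.log_nonneg hx), one_div_mul_cancel (by exact_mod_cast hφ), Real.rpow_one]
    ring
  rcases hD0.eq_or_lt with rfl | hDpos
  · have hinv : Tendsto (fun x => (R x)⁻¹) atTop atTop :=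
      (tendsto_nhdsWithin_iff.2 ⟨hD, Eventually.of_forall hRpos⟩).inv_tendsto_nhdsGT_zero
    refine absurd ((hN.pos_mul_atTop hCφ hinv).congr fun x => ?_)
      not_tendsto_log_mul_mertensProduct_atTop
    exact mul_inv_cancel_right₀ (hRpos x).ne' _
  · have hL := (hN.div hD hDpos.ne').congr fun x => mul_div_cancel_right₀ _ (hRpos x).ne'
    rw [← eq_exp_neg_of_tendsto_log_mul_mertensProduct (div_pos hCφ hDpos) hL,
      div_mul_cancel₀ _ hDpos.ne']
end

section
/- Let q ≥ 3 be an integer. For a prime p set α(p; q, 1) = φ(q) − 1 if p ≡ 1 (mod q) and α(p; q, 1) = −1 otherwise. Then the limit c(q, 1) = lim_{x → ∞} ∏_{p ≤ x, p ∤ q} (1 − 1/p)^{α(p; q, 1)} exists and equals Π(q, 1) · ∏_{b ∈ (ℤ/qℤ)ˣ, b ≠ 1} ∏_{p ≡ b (mod q)} (1 − p^{−t_b})^{−φ(q)/t_b}, where t_b is the multiplicative order of b in (ℤ/qℤ)ˣ, the inner products over primes p ≡ b (mod q) are absolutely convergent, and Π(q, 1) = ∏_{χ mod q, χ ≠ χ₀}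 L(1, χ)^{−1}, the product over all non-principal Dirichlet characters modulo q with L(s, χ) the Dirichlet L-function. -/
open Filter Topology Finset

/-- **Abel's inequality**. -/
theorem norm_sum_Ico_mul_le_of_antitoneOn {a : ℕ → ℝ} {z : ℕ → ℂ} {m : ℕ} {C : ℝ}
    (ha : AntitoneOn a (Set.Ici m)) (ha₀ : ∀ n, m ≤ n → 0 ≤ a n)
    (hz : ∀ n, m ≤ n → ‖∑ k ∈ Ico m n, z k‖ ≤ C) {n : ℕ} (hn : m ≤ n) :
    ‖∑ k ∈ Ico m n, (a k : ℂ) * z k‖ ≤ C * a m := by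
  have key : ∀ n, m ≤ n → ∑ k ∈ Ico m n, (a k : ℂ) * z k = (a n : ℂ) * ∑ k ∈ Ico m n, z k +
      ∑ k ∈ Ico m n, ((a k - a (k + 1) : ℝ) : ℂ) * ∑ j ∈ Ico m (k + 1), z j := by
    intro n hn
    induction n, hn using Nat.le_induction with
    | base => simp
    | succ n hn ih =>
      rw [sum_Ico_succ_top hn, sum_Ico_succ_top hn, sum_Ico_succ_top hn, ih, sum_Ico_succ_top hn]
      push_cast
      ring
  have tele : ∀ n, m ≤ n → ∑ k ∈ Ico m n, (a k - a (k + 1)) = a m - a n := by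
    intro n hn
    induction n, hn using Nat.le_induction with
    | base => simp
    | succ n hn ih => rw [sum_Ico_succ_top hn, ih]; ring
  rw [key n hn]
  calc _ ≤ a n * C + ∑ k ∈ Ico m n, (a k - a (k + 1)) * C := by
        refine norm_add_le_of_le ?_ (norm_sum_le_of_le _ fun k hk ↦ ?_)
        · rw [norm_mul, Complex.norm_of_nonneg (ha₀ n hn)]
          exact mul_le_mul_of_nonneg_left (hz n hn) (ha₀ n hn)
        · have hk := (mem_Ico.mp hk).1
          have h : 0 ≤ a k - a (k + 1) :=
            sub_nonneg.mpr (ha (Set.mem_Ici.mpr hk) (Set.mem_Ici.mpr (by omega)) (by omega))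
          rw [norm_mul, Complex.norm_of_nonneg h]
          exact mul_le_mul_of_nonneg_left (hz _ (by omega)) h
    _ = C * a m := by rw [← sum_mul, tele n hn]; ring

theorem norm_sum_Ico_le_of_norm_sum_range_le {z : ℕ → ℂ} {C : ℝ}
    (hz : ∀ n, ‖∑ k ∈ range n, z k‖ ≤ C) {m n : ℕ} (hmn : m ≤ n) :
    ‖∑ k ∈ Ico m n, z k‖ ≤ 2 * C := by
  rw [sum_Ico_eq_sub _ hmn]
  linarith [norm_sub_le (∑ k ∈ range n, z k) (∑ k ∈ range m, z k), hz n, hz m]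

/-- **Dirichlet's test**, with a bound for the remainder. -/
theorem exists_tendsto_sum_range_mul_of_antitoneOn {a : ℕ → ℝ} {z : ℕ → ℂ} {m : ℕ} {C : ℝ}
    (ha : AntitoneOn a (Set.Ici m)) (ha₀ : ∀ n, m ≤ n → 0 ≤ a n)
    (ha' : Tendsto a atTop (𝓝 0)) (hz : ∀ n, ‖∑ k ∈ range n, z k‖ ≤ C) :
    ∃ A : ℂ, Tendsto (fun n ↦ ∑ k ∈ range n, (a k : ℂ) * z k) atTop (𝓝 A) ∧
      ∀ n, m ≤ n → ‖(∑ k ∈ range n, (a k : ℂ) * z k) - A‖ ≤ 2 * C * a n := by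
  have hb : ∀ i n, m ≤ i → i ≤ n →
      ‖∑ k ∈ range i, (a k : ℂ) * z k - ∑ k ∈ range n, (a k : ℂ) * z k‖ ≤ 2 * C * a i := by
    intro i n hi hn
    rw [norm_sub_rev, ← sum_Ico_eq_sub _ hn]
    exact norm_sum_Ico_mul_le_of_antitoneOn (ha.mono (Set.Ici_subset_Ici.mpr hi))
      (fun k hk ↦ ha₀ k (hi.trans hk))
      (fun k hk ↦ norm_sum_Ico_le_of_norm_sum_range_le hz hk) hn
  have hc : CauchySeq (fun n ↦ ∑ k ∈ range n, (a k : ℂ) * z k) := by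
    refine Metric.cauchySeq_iff'.mpr fun ε hε ↦ ?_
    have h0 : Tendsto (fun n ↦ 2 * C * a n) atTop (𝓝 0) := by
      simpa using ha'.const_mul (2 * C)
    obtain ⟨N, hN⟩ := ((h0.eventually_lt_const hε).and (eventually_ge_atTop m)).exists
    refine ⟨N, fun n hn ↦ ?_⟩
    rw [dist_eq_norm, norm_sub_rev]
    exact (hb N n hN.2 hn).trans_lt hN.1
  obtain ⟨A, hA⟩ := cauchySeq_tendsto_of_complete hc
  refine ⟨A, hA, fun n hn ↦ ?_⟩
  refine le_of_tendsto (hA.const_sub _).norm ?_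
  filter_upwards [eventually_ge_atTop n] with k hk using hb n k hn hk

/-- An Abelian theorem for Dirichlet series at the boundary point `0`. -/
theorem tendsto_tsum_rpow_neg_mul_of_tendsto_sum_range {b : ℕ → ℂ} {A : ℂ} (hb₀ : b 0 = 0)
    (hb : Tendsto (fun n ↦ ∑ k ∈ range n, b k) atTop (𝓝 A))
    (hs : ∀ δ : ℝ, 0 < δ → Summable fun n : ℕ ↦ (((n : ℝ) ^ (-δ) : ℝ) : ℂ) * b n) :
    Tendsto (fun δ : ℝ ↦ ∑' n : ℕ, (((n : ℝ) ^ (-δ) : ℝ) : ℂ) * b n) (𝓝[>] 0) (𝓝 A) := by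
  refine Metric.tendsto_nhds.mpr fun ε hε ↦ ?_
  have hε3 : 0 < ε / 3 := by positivity
  obtain ⟨N₀, hN₀⟩ := Metric.cauchySeq_iff.mp hb.cauchySeq (ε / 3) hε3
  obtain ⟨N, ⟨hN1, hN2⟩, hN3⟩ := (((eventually_ge_atTop N₀).and (eventually_ge_atTop 1)).and
    (Metric.tendsto_nhds.mp hb (ε / 3) hε3)).exists
  have hfin : Tendsto (fun δ : ℝ ↦ ∑ n ∈ range N, (((n : ℝ) ^ (-δ) : ℝ) : ℂ) * b n) (𝓝[>] 0)
      (𝓝 (∑ n ∈ range N, b n)) := by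
    refine tendsto_finsetSum _ fun n _ ↦ ?_
    rcases Nat.eq_zero_or_pos n with rfl | hn
    · simp [hb₀]
    · have hn' : (n : ℝ) ≠ 0 := by positivity
      have h1 : ContinuousAt (fun δ : ℝ ↦ (((n : ℝ) ^ (-δ) : ℝ) : ℂ) * b n) 0 :=
        (Complex.continuous_ofReal.continuousAt.comp
          ((Real.continuousAt_const_rpow hn').comp continuous_neg.continuousAt)).mul
          continuousAt_const
      simpa using! h1.tendsto.mono_left nhdsWithin_le_nhds
  filter_upwards [Metric.tendsto_nhds.mp hfin (ε / 3) hε3, self_mem_nhdsWithin] with δ hδ hδ0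
  have hδ0 : 0 < δ := hδ0
  have htail : dist (∑' n : ℕ, (((n : ℝ) ^ (-δ) : ℝ) : ℂ) * b n)
      (∑ n ∈ range N, (((n : ℝ) ^ (-δ) : ℝ) : ℂ) * b n) ≤ ε / 3 := by
    refine le_of_tendsto ((hs δ hδ0).hasSum.tendsto_sum_nat.dist tendsto_const_nhds) ?_
    filter_upwards [eventually_ge_atTop N] with n hn
    rw [dist_eq_norm, ← sum_Ico_eq_sub _ hn]
    refine (norm_sum_Ico_mul_le_of_antitoneOn (C := ε / 3) (fun i hi j hj hij ↦ ?_)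
      (fun k _ ↦ by positivity) (fun k hk ↦ ?_) hn).trans ?_
    · have hi' : 1 ≤ i := hN2.trans hi
      exact Real.rpow_le_rpow_of_nonpos (by positivity) (by exact_mod_cast hij) (by linarith)
    · rw [sum_Ico_eq_sub _ hk, ← dist_eq_norm]
      exact (hN₀ k (hN1.trans hk) N hN1).le
    · refine mul_le_of_le_one_right hε3.le ?_
      exact Real.rpow_le_one_of_one_le_of_nonpos (by exact_mod_cast hN2) (by linarith)
  calc _ ≤ _ := dist_triangle4 _ _ _ _
    _ < ε / 3 + ε / 3 + ε / 3 := add_lt_add (add_lt_add_of_le_of_lt htail hδ) hN3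
    _ = ε := by ring

namespace DirichletCharacter

variable {q : ℕ} [NeZero q] {χ : DirichletCharacter ℂ q}

theorem sum_range_natCast_eq_zero (hχ : χ ≠ 1) : ∑ k ∈ range q, χ (k : ZMod q) = 0 := by
  rw [← MulChar.sum_eq_zero_of_ne_one hχ]
  refine sum_nbij' (fun k : ℕ ↦ (k : ZMod q)) ZMod.val (by simp)
    (fun a _ ↦ mem_range.mpr a.val_lt) (fun k hk ↦ ZMod.val_cast_of_lt (mem_range.mp hk))
    (by simp) (by simp)

theorem norm_sum_range_natCast_le (hχ : χ ≠ 1) (n : ℕ) :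
    ‖∑ k ∈ range n, χ (k : ZMod q)‖ ≤ q := by
  induction n using Nat.strong_induction_on with
  | _ n ih =>
    rcases lt_or_ge n q with h | h
    · calc _ ≤ ∑ k ∈ range n, (1 : ℝ) := norm_sum_le_of_le _ fun k _ ↦ χ.norm_le_one _
        _ ≤ q := by simpa using h.le
    · obtain ⟨m, rfl⟩ := Nat.exists_eq_add_of_le h
      rw [sum_range_add, sum_range_natCast_eq_zero hχ, zero_add]
      simpa using ih m (Nat.lt_add_of_pos_left (Nat.pos_of_neZero q))

theorem term_one_add_eq (f : ℕ → ℂ) {δ : ℝ} (n : ℕ) :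
    LSeries.term f (1 + δ) n = (((n : ℝ) ^ (-δ) : ℝ) : ℂ) * (((1 / n : ℝ) : ℂ) * f n) := by
  rcases eq_or_ne n 0 with rfl | hn
  · simp
  · have hn' : (n : ℂ) ≠ 0 := by exact_mod_cast hn
    rw [LSeries.term_of_ne_zero hn, Complex.cpow_add _ _ hn', Complex.cpow_one,
      Complex.ofReal_cpow (by positivity), Complex.ofReal_natCast, Complex.ofReal_neg,
      Complex.cpow_neg]
    push_cast
    field_simp

theorem tendsto_LSeries_one_add (hχ : χ ≠ 1) :
    Tendsto (fun δ : ℝ ↦ LSeries (fun n ↦ χ (n : ZMod q)) (1 + δ)) (𝓝[>] 0)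
      (𝓝 (LFunction χ 1)) := by
  have h : Tendsto (fun δ : ℝ ↦ LFunction χ (1 + δ)) (𝓝[>] 0) (𝓝 (LFunction χ 1)) := by
    have : Continuous (fun δ : ℝ ↦ LFunction χ (1 + δ)) :=
      (differentiable_LFunction hχ).continuous.comp (by fun_prop)
    simpa using! (this.tendsto 0).mono_left nhdsWithin_le_nhds
  refine h.congr' ?_
  filter_upwards [self_mem_nhdsWithin] with δ hδ
  exact LFunction_eq_LSeries χ (by simpa using hδ)

/-- The series `∑ χ(n)/n` converges to `L(1, χ)`, with remainder `O(1/n)`. -/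
theorem norm_sum_range_sub_LFunction_one_le (hχ : χ ≠ 1) {n : ℕ} (hn : 1 ≤ n) :
    ‖(∑ k ∈ range n, ((1 / k : ℝ) : ℂ) * χ (k : ZMod q)) - LFunction χ 1‖ ≤
      2 * q * (1 / n : ℝ) := by
  obtain ⟨A, hA, hA'⟩ := exists_tendsto_sum_range_mul_of_antitoneOn
    (a := fun k : ℕ ↦ (1 / k : ℝ)) (m := 1)
    (fun i hi j hj hij ↦ one_div_le_one_div_of_le (by exact_mod_cast (hi : 1 ≤ i))
      (by exact_mod_cast hij))
    (fun k _ ↦ by positivity) tendsto_one_div_atTop_nhds_zero_nat (norm_sum_range_natCast_le hχ)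
  suffices A = LFunction χ 1 from this ▸ hA' n hn
  refine tendsto_nhds_unique ((tendsto_tsum_rpow_neg_mul_of_tendsto_sum_range (by simp) hA
    fun δ hδ ↦ ?_).congr fun δ ↦ ?_) (tendsto_LSeries_one_add hχ)
  · simp_rw [← term_one_add_eq (fun n ↦ χ (n : ZMod q))]
    exact LSeriesSummable_of_one_lt_re χ (by simpa using hδ)
  · simp_rw [← term_one_add_eq (fun n ↦ χ (n : ZMod q))]
    rfl

theorem exists_norm_sum_range_log_div_mul_le (hχ : χ ≠ 1) :
    ∃ C : ℝ, ∀ n, ‖∑ k ∈ range n, ((Real.log k / k : ℝ) : ℂ) * χ (k : ZMod q)‖ ≤ C := by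
  have he {i : ℕ} (hi : 3 ≤ i) : Real.exp 1 ≤ i :=
    Real.exp_one_lt_three.le.trans (by exact_mod_cast hi)
  obtain ⟨A, hA, -⟩ := exists_tendsto_sum_range_mul_of_antitoneOn
    (a := fun k : ℕ ↦ (Real.log k / k : ℝ)) (m := 3)
    (fun i hi j hj hij ↦ Real.log_div_self_antitoneOn (he hi) (he hj) (by exact_mod_cast hij))
    (fun k _ ↦ by positivity)
    ((Real.isLittleO_log_id_atTop.tendsto_div_nhds_zero).comp tendsto_natCast_atTop_atTop)
    (norm_sum_range_natCast_le hχ)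
  obtain ⟨C, hC⟩ := hA.norm.bddAbove_range
  exact ⟨C, fun n ↦ hC ⟨n, rfl⟩⟩

open ArithmeticFunction in
/-- The partial sums of `∑ χ(n) Λ(n) / n` are bounded. -/
theorem exists_norm_sum_range_vonMangoldt_div_mul_le (hχ : χ ≠ 1) :
    ∃ C : ℝ, ∀ n, ‖∑ k ∈ range n, ((vonMangoldt k / k : ℝ) : ℂ) * χ (k : ZMod q)‖ ≤ C := by
  obtain ⟨C, hC⟩ := exists_norm_sum_range_log_div_mul_le hχ
  set L := LFunction χ 1
  have hL : 0 < ‖L‖ := norm_pos_iff.mpr (LFunction_apply_one_ne_zero hχ)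
  let f : ArithmeticFunction ℂ :=
    ⟨fun k ↦ ((vonMangoldt k / k : ℝ) : ℂ) * χ (k : ZMod q), by simp⟩
  let g : ArithmeticFunction ℂ := ⟨fun k ↦ ((1 / k : ℝ) : ℂ) * χ (k : ZMod q), by simp⟩
  have hfg (n : ℕ) : (f * g) n = ((Real.log n / n : ℝ) : ℂ) * χ (n : ZMod q) := by
    rw [← vonMangoldt_sum, mul_apply, Nat.sum_divisorsAntidiagonal (fun i j ↦ f i * g j)]
    push_cast
    rw [sum_div, sum_mul]
    refine sum_congr rfl fun d hd ↦ ?_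
    obtain ⟨⟨e, rfl⟩, hn⟩ := Nat.mem_divisors.mp hd
    have hd0 : d ≠ 0 := left_ne_zero_of_mul hn
    have he0 : e ≠ 0 := right_ne_zero_of_mul hn
    rw [Nat.mul_div_cancel_left _ (Nat.pos_of_ne_zero hd0)]
    simp only [f, g, coe_mk]
    push_cast
    rw [map_mul]
    field_simp
  have hrange (F : ArithmeticFunction ℂ) (N : ℕ) :
      ∑ k ∈ range (N + 1), F k = ∑ k ∈ Ioc 0 N, F k := by
    rw [range_eq_Ico, sum_eq_sum_Ico_succ_bot (by omega)]
    rw [ArithmeticFunction.map_zero, zero_add]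
    rfl
  have hbound (N : ℕ) : ‖∑ k ∈ range (N + 1), f k‖ ≤
      (C + 2 * q * (Real.log 4 + 4)) / ‖L‖ := by
    rw [le_div_iff₀ hL, ← norm_mul, hrange]
    have h1 : (∑ d ∈ Ioc 0 N, f d) * L = ∑ k ∈ range (N + 1), (f * g) k -
        ∑ d ∈ Ioc 0 N, f d * ((∑ m ∈ range (N / d + 1), g m) - L) := by
      rw [hrange, sum_Ioc_mul_eq_sum_sum, sum_mul, ← sum_sub_distrib]
      refine sum_congr rfl fun d _ ↦ ?_
      rw [hrange]
      ring
    rw [h1]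
    refine norm_sub_le_of_le ?_ ?_
    · simp_rw [hfg]
      exact hC _
    · calc _ ≤ ∑ d ∈ Ioc 0 N, vonMangoldt d * (2 * q / N) := by
            refine norm_sum_le_of_le _ fun d hd ↦ ?_
            obtain ⟨hd0, hdN⟩ := mem_Ioc.mp hd
            have hN : 0 < (N : ℝ) := by exact_mod_cast hd0.trans_le hdN
            have hd0' : 0 < (d : ℝ) := by exact_mod_cast hd0
            have hf : ‖f d‖ ≤ vonMangoldt d / d := by
              simp only [f, coe_mk, norm_mul]
              rw [Complex.norm_of_nonneg (div_nonneg vonMangoldt_nonneg hd0'.le)]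
              exact mul_le_of_le_one_right (div_nonneg vonMangoldt_nonneg hd0'.le)
                (χ.norm_le_one _)
            have hg : ‖(∑ m ∈ range (N / d + 1), g m) - L‖ ≤ 2 * q * (d / N) := by
              refine (norm_sum_range_sub_LFunction_one_le hχ (Nat.succ_pos _)).trans ?_
              refine mul_le_mul_of_nonneg_left ?_ (by positivity)
              rw [div_le_div_iff₀ (by positivity) hN, one_mul]
              exact_mod_cast (Nat.lt_mul_div_succ N hd0).le
            rw [norm_mul]
            calc _ ≤ vonMangoldt d / d * (2 * q * (d / N)) :=
                  mul_le_mul hf hg (norm_nonneg _) (div_nonneg vonMangoldt_nonneg hd0'.le)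
              _ = _ := by field_simp
        _ ≤ 2 * q * (Real.log 4 + 4) := by
            rw [← sum_mul]
            rcases Nat.eq_zero_or_pos N with rfl | hN
            · simp only [Ioc_self, sum_empty, zero_mul]
              positivity
            · have hN' : 0 < (N : ℝ) := by exact_mod_cast hN
              have := Chebyshev.psi_le_const_mul_self hN'.le
              rw [Chebyshev.psi, Nat.floor_natCast] at this
              calc _ ≤ (Real.log 4 + 4) * N * (2 * q / N) :=
                    mul_le_mul_of_nonneg_right this (by positivity)
                _ = _ := by field_simp
  refine ⟨(C + 2 * q * (Real.log 4 + 4)) / ‖L‖, fun n ↦ ?_⟩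
  rcases n with _ | n
  · rw [range_zero, sum_empty, norm_zero]
    exact (norm_nonneg _).trans (hbound 0)
  · exact hbound n

open ArithmeticFunction in
theorem exists_norm_sum_range_prime_log_div_mul_le (hχ : χ ≠ 1) :
    ∃ C : ℝ, ∀ n, ‖∑ k ∈ range n,
      if k.Prime then ((Real.log k / k : ℝ) : ℂ) * χ (k : ZMod q) else 0‖ ≤ C := by
  obtain ⟨C, hC⟩ := exists_norm_sum_range_vonMangoldt_div_mul_le hχ
  have hsum : Summable fun n : ℕ ↦ (if n.Prime then 0 else vonMangoldt n) / (n : ℝ) := by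
    refine (vonMangoldt.summable_residueClass_non_primes_div (1 : ZMod 1)).congr fun n ↦ ?_
    rw [vonMangoldt.residueClass, Set.indicator_of_mem]
    exact Subsingleton.elim _ _
  have hnn (n : ℕ) : 0 ≤ (if n.Prime then 0 else vonMangoldt n) / (n : ℝ) := by
    split_ifs
    · simp
    · exact div_nonneg vonMangoldt_nonneg n.cast_nonneg
  refine ⟨C + ∑' n : ℕ, (if n.Prime then 0 else vonMangoldt n) / (n : ℝ), fun n ↦ ?_⟩
  have hsplit : (∑ k ∈ range n,
      if k.Prime then ((Real.log k / k : ℝ) : ℂ) * χ (k : ZMod q) else 0) =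
      ∑ k ∈ range n, ((vonMangoldt k / k : ℝ) : ℂ) * χ (k : ZMod q) -
      ∑ k ∈ range n, (((if k.Prime then 0 else vonMangoldt k) / (k : ℝ) : ℝ) : ℂ) *
        χ (k : ZMod q) := by
    rw [← sum_sub_distrib]
    refine sum_congr rfl fun k _ ↦ ?_
    split_ifs with hk
    · simp [vonMangoldt_apply_prime hk]
    · simp
  rw [hsplit]
  refine norm_sub_le_of_le (hC n) ((norm_sum_le_of_le _ fun k _ ↦ ?_).trans
    (hsum.sum_le_tsum _ fun k _ ↦ hnn k))
  rw [norm_mul, Complex.norm_of_nonneg (hnn k)]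
  exact mul_le_of_le_one_right (hnn k) (χ.norm_le_one _)

theorem exists_tendsto_sum_range_prime_div (hχ : χ ≠ 1) :
    ∃ A : ℂ, Tendsto (fun n ↦ ∑ k ∈ range n, ((1 / k : ℝ) : ℂ) *
      if k.Prime then χ (k : ZMod q) else 0) atTop (𝓝 A) := by
  obtain ⟨C, hC⟩ := exists_norm_sum_range_prime_log_div_mul_le hχ
  have hlog {k : ℕ} (hk : 2 ≤ k) : 0 < Real.log k := Real.log_pos (by exact_mod_cast hk)
  obtain ⟨A, hA, -⟩ := exists_tendsto_sum_range_mul_of_antitoneOn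
    (a := fun k : ℕ ↦ 1 / Real.log k) (m := 2)
    (fun i hi j hj hij ↦ one_div_le_one_div_of_le (hlog hi)
      (Real.log_le_log (by have : 2 ≤ i := hi; positivity) (by exact_mod_cast hij)))
    (fun k _ ↦ by positivity)
    ((Real.tendsto_log_atTop.comp tendsto_natCast_atTop_atTop).const_div_atTop 1) hC
  refine ⟨A, hA.congr fun n ↦ sum_congr rfl fun k _ ↦ ?_⟩
  split_ifs with hk
  · have := (hlog hk.two_le).ne'
    have hk' : (k : ℂ) ≠ 0 := by exact_mod_cast hk.ne_zero
    have hl : (Real.log k : ℂ) ≠ 0 := by exact_mod_cast this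
    rw [Complex.ofReal_div, Complex.ofReal_div, Complex.ofReal_div]
    push_cast at hl ⊢
    field_simp
  · simp

theorem norm_neg_log_one_sub_sub_self_le {z : ℂ} (hz : ‖z‖ ≤ 1 / 2) :
    ‖-Complex.log (1 - z) - z‖ ≤ ‖z‖ ^ 2 := by
  have h := Complex.norm_log_one_add_sub_self_le (z := -z) (by rw [norm_neg]; linarith)
  rw [norm_neg, ← sub_eq_add_neg, sub_neg_eq_add] at h
  rw [← norm_neg, neg_sub, sub_neg_eq_add, add_comm]
  have h2 : (1 - ‖z‖)⁻¹ ≤ 2 := by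
    rw [inv_le_comm₀ (by linarith) two_pos]
    linarith
  nlinarith [mul_le_mul_of_nonneg_left h2 (sq_nonneg ‖z‖)]

theorem norm_rpow_neg_mul_one_div_mul_le {q : ℕ} {χ : DirichletCharacter ℂ q} {δ : ℝ}
    (hδ : 0 ≤ δ) {k : ℕ} (hk : k.Prime) :
    ‖(((k : ℝ) ^ (-δ) : ℝ) : ℂ) * (((1 / k : ℝ) : ℂ) * χ (k : ZMod q))‖ ≤ 1 / k := by
  rw [norm_mul, norm_mul, Complex.norm_of_nonneg (by positivity),
    Complex.norm_of_nonneg (by positivity)]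
  have h1 : (k : ℝ) ^ (-δ) ≤ 1 :=
    Real.rpow_le_one_of_one_le_of_nonpos (by exact_mod_cast hk.one_le) (by linarith)
  calc _ ≤ 1 * (1 / (k : ℝ) * 1) := by
        gcongr
        exact χ.norm_le_one _
    _ = _ := by ring

/-- The Euler product of a nontrivial Dirichlet `L`-function converges at `s = 1`. -/
theorem tendsto_prod_primesBelow_one_sub (hχ : χ ≠ 1) :
    Tendsto (fun n : ℕ ↦ ∏ p ∈ n.primesBelow, (1 - χ (p : ZMod q) / (p : ℂ))) atTop
      (𝓝 (LFunction χ 1)⁻¹) := by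
  obtain ⟨A, hA⟩ := exists_tendsto_sum_range_prime_div hχ
  set b : ℕ → ℂ := fun k ↦ ((1 / k : ℝ) : ℂ) * if k.Prime then χ (k : ZMod q) else 0 with hb
  let w : ℝ → ℕ → ℂ := fun δ k ↦ (((k : ℝ) ^ (-δ) : ℝ) : ℂ) * (((1 / k : ℝ) : ℂ) * χ (k : ZMod q))
  let G : ℝ → ℕ → ℂ := fun δ k ↦ if k.Prime then -Complex.log (1 - w δ k) - w δ k else 0
  have hw {δ : ℝ} (hδ : 0 ≤ δ) {k : ℕ} (hk : k.Prime) : ‖w δ k‖ ≤ 1 / k :=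
    norm_rpow_neg_mul_one_div_mul_le hδ hk
  have hhalf {k : ℕ} (hk : k.Prime) : (1 / k : ℝ) ≤ 1 / 2 :=
    one_div_le_one_div_of_le two_pos (by exact_mod_cast hk.two_le)
  have hG {δ : ℝ} (hδ : 0 ≤ δ) (k : ℕ) : ‖G δ k‖ ≤ 1 / (k : ℝ) ^ 2 := by
    simp only [G]
    split_ifs with hk
    · refine (norm_neg_log_one_sub_sub_self_le ((hw hδ hk).trans (hhalf hk))).trans ?_
      rw [← one_div_pow]
      exact pow_le_pow_left₀ (norm_nonneg _) (hw hδ hk) 2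
    · rw [norm_zero]
      positivity
  have hsq : Summable fun k : ℕ ↦ 1 / (k : ℝ) ^ 2 := Real.summable_one_div_nat_pow.mpr one_lt_two
  have hslit {δ : ℝ} (hδ : 0 ≤ δ) {k : ℕ} (hk : k.Prime) : 1 - w δ k ∈ Complex.slitPlane := by
    have := Complex.mem_slitPlane_of_norm_lt_one (z := -w δ k)
      (by rw [norm_neg]; linarith [hw hδ hk, hhalf hk])
    rwa [← sub_eq_add_neg] at this
  have hGlim : Tendsto (fun δ ↦ ∑' k, G δ k) (𝓝[>] 0) (𝓝 (∑' k, G 0 k)) := by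
    refine tendsto_tsum_of_dominated_convergence hsq (fun k ↦ ?_) ?_
    · simp only [G]
      split_ifs with hk
      · have hwc : ContinuousAt (fun δ ↦ w δ k) 0 := by
          have hk' : (k : ℝ) ≠ 0 := by exact_mod_cast hk.ne_zero
          exact (Complex.continuous_ofReal.continuousAt.comp
            ((Real.continuousAt_const_rpow hk').comp continuous_neg.continuousAt)).mul
            continuousAt_const
        exact (((continuousAt_const.sub hwc).clog (hslit le_rfl hk)).neg.sub hwc).tendsto.mono_left
          nhdsWithin_le_nhds
      · exact tendsto_const_nhds
    · filter_upwards [self_mem_nhdsWithin] with δ hδ k using hG (le_of_lt hδ) k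
  have hterm (δ : ℝ) (n : ℕ) : (((n : ℝ) ^ (-δ) : ℝ) : ℂ) * b n =
      {k : ℕ | k.Prime}.indicator (LSeries.term (fun n ↦ χ (n : ZMod q)) (1 + δ)) n := by
    simp only [Set.indicator_apply, Set.mem_ofPred_eq, term_one_add_eq, hb]
    split_ifs <;> simp
  have hsum {δ : ℝ} (hδ : 0 < δ) : Summable fun n : ℕ ↦ (((n : ℝ) ^ (-δ) : ℝ) : ℂ) * b n := by
    simp_rw [hterm]
    exact Summable.indicator (LSeriesSummable_of_one_lt_re χ (by simpa using hδ)) _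
  have hAbel := tendsto_tsum_rpow_neg_mul_of_tendsto_sum_range (by simp) hA
    fun δ hδ ↦ hsum hδ
  have hexp : Complex.exp (A + ∑' k, G 0 k) = LFunction χ 1 := by
    refine tendsto_nhds_unique ((hAbel.add hGlim).cexp.congr' ?_) (tendsto_LSeries_one_add hχ)
    filter_upwards [self_mem_nhdsWithin] with δ hδ
    have hδ : 0 < δ := hδ
    have hδ' : 1 < (1 + δ : ℂ).re := by simpa using hδ
    rw [← LSeries_eulerProduct_exp_log χ hδ',
      ← (hsum hδ).tsum_add (hsq.of_norm_bounded (hG hδ.le))]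
    congr 1
    refine Eq.trans ?_ (tsum_subtype {k : ℕ | k.Prime}
      (fun k ↦ -Complex.log (1 - χ (k : ZMod q) * (k : ℂ) ^ (-(1 + δ : ℂ))))).symm
    refine tsum_congr fun k ↦ ?_
    by_cases hk : k.Prime
    · have hwk : w δ k = χ (k : ZMod q) * (k : ℂ) ^ (-(1 + δ : ℂ)) := by
        simp only [w]
        rw [← term_one_add_eq (fun n ↦ χ (n : ZMod q)), LSeries.term_of_ne_zero hk.ne_zero,
          Complex.cpow_neg, div_eq_mul_inv]
      rw [Set.indicator_of_mem (by exact hk), ← hwk]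
      simp only [G, hb, if_pos hk, w]
      ring
    · rw [Set.indicator_of_notMem (by exact hk)]
      simp [G, hb, if_neg hk]
  rw [← hexp, ← Complex.exp_neg]
  have hG0 : Tendsto (fun n ↦ ∑ k ∈ range n, G 0 k) atTop (𝓝 (∑' k, G 0 k)) :=
    (hsq.of_norm_bounded (hG le_rfl)).hasSum.tendsto_sum_nat
  refine (hA.add hG0).neg.cexp.congr fun n ↦ ?_
  rw [← sum_add_distrib, ← sum_neg_distrib, Complex.exp_sum, Nat.primesBelow, prod_filter]
  refine prod_congr rfl fun k _ ↦ ?_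
  by_cases hk : k.Prime
  · have hwk : w 0 k = χ (k : ZMod q) / k := by
      simp only [w, neg_zero, Real.rpow_zero]
      push_cast
      ring
    have hbk : ((1 / k : ℝ) : ℂ) * χ (k : ZMod q) = w 0 k := by simp [w]
    simp only [G, if_pos hk]
    rw [hbk, ← hwk, add_sub_cancel, neg_neg, Complex.exp_log (Complex.slitPlane_ne_zero
      (hslit le_rfl hk))]
  · simp [G, hk]

/-- Evaluation of Dirichlet characters at a unit, as a group homomorphism. -/
noncomputable def evalUnitHom {q : ℕ} (b : (ZMod q)ˣ) : DirichletCharacter ℂ q →* ℂˣ where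
  toFun χ := χ.toUnitHom b
  map_one' := by ext; simp
  map_mul' χ ψ := by ext; simp

theorem coe_evalUnitHom {q : ℕ} (b : (ZMod q)ˣ) (χ : DirichletCharacter ℂ q) :
    (evalUnitHom b χ : ℂ) = χ b :=
  χ.coe_toUnitHom b

theorem range_evalUnitHom (b : (ZMod q)ˣ) :
    (evalUnitHom b).range = rootsOfUnity (orderOf b) ℂ := by
  have : NeZero (orderOf b) := ⟨(orderOf_pos b).ne'⟩
  refine Subgroup.eq_of_le_of_card_ge ?_ ?_
  · rintro _ ⟨χ, rfl⟩
    rw [mem_rootsOfUnity]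
    change χ.toUnitHom b ^ orderOf b = 1
    rw [← map_pow, pow_orderOf_eq_one, map_one]
  · rw [Complex.card_rootsOfUnity]
    refine Nat.le_of_dvd Nat.card_pos (orderOf_dvd_of_pow_eq_one ?_)
    by_contra hne
    obtain ⟨χ, hχ⟩ := exists_apply_ne_one_of_hasEnoughRootsOfUnity ℂ
      (a := ((b ^ Nat.card (evalUnitHom b).range : (ZMod q)ˣ) : ZMod q))
      (by rwa [Ne, Units.val_eq_one])
    apply hχ
    have h := pow_card_eq_one' (x := (⟨evalUnitHom b χ, χ, rfl⟩ : (evalUnitHom b).range))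
    rw [Subtype.ext_iff] at h
    have h' := congrArg (Units.val) h
    simpa [coe_evalUnitHom] using h'

/-- The product of the Euler factors at a prime in the class of `b` over all characters. -/
theorem prod_one_sub_apply_mul (b : (ZMod q)ˣ) (z : ℂ) :
    ∏ χ : DirichletCharacter ℂ q, (1 - χ b * z) =
      (1 - z ^ orderOf b) ^ (q.totient / orderOf b) := by
  classical
  have hpos := orderOf_pos b
  have : NeZero (orderOf b) := ⟨hpos.ne'⟩
  let ev : DirichletCharacter ℂ q →* ℂ := (Units.coeHom ℂ).comp (evalUnitHom b)
  have hev (χ : DirichletCharacter ℂ q) : ev χ = χ b := coe_evalUnitHom b χ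
  have himage : univ.image ev = Polynomial.nthRootsFinset (orderOf b) (1 : ℂ) := by
    ext ζ
    rw [Polynomial.mem_nthRootsFinset hpos]
    simp only [mem_image, mem_univ, true_and]
    constructor
    · rintro ⟨χ, rfl⟩
      rw [hev, ← map_pow, ← Units.val_pow_eq_pow_val, pow_orderOf_eq_one, Units.val_one, map_one]
    · intro hζ
      have hmem : Units.ofPowEqOne ζ _ hζ hpos.ne' ∈ (evalUnitHom b).range := by
        rw [range_evalUnitHom, mem_rootsOfUnity]
        ext
        simp
      obtain ⟨χ, hχ⟩ := hmem
      exact ⟨χ, congrArg Units.val hχ⟩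
  have hprim := Complex.isPrimitiveRoot_exp (orderOf b) hpos.ne'
  have hfiber : ∀ ζ ∈ univ.image ev, #{χ | ev χ = ζ} = #{χ | ev χ = 1} := by
    intro ζ hζ
    refine MonoidHom.card_fiber_eq_of_mem_range ev ?_ ⟨1, map_one ev⟩
    obtain ⟨χ, -, h⟩ := mem_image.mp hζ
    exact ⟨χ, h⟩
  have hcard : orderOf b * #{χ | ev χ = 1} = q.totient := by
    rw [← card_eq_totient_of_hasEnoughRootsOfUnity ℂ q, Nat.card_eq_fintype_card,
      ← card_univ, card_eq_sum_card_image ev univ, sum_congr rfl hfiber, sum_const, himage,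
      hprim.card_nthRootsFinset, smul_eq_mul]
  rw [← hcard, Nat.mul_div_cancel_left _ hpos]
  simp_rw [← hev]
  rw [prod_comp (fun ζ ↦ 1 - ζ * z) ev,
    prod_congr rfl fun ζ hζ ↦ congrArg ((1 - ζ * z) ^ ·) (hfiber ζ hζ), prod_pow, himage]
  congr 1
  simpa using (hprim.pow_sub_pow_eq_prod_sub_mul 1 z hpos).symm

open scoped Classical in
theorem prod_ne_one_one_sub_apply_mul_mul (b : (ZMod q)ˣ) (z : ℂ) :
    (∏ χ ∈ univ.filter (fun χ : DirichletCharacter ℂ q ↦ χ ≠ 1), (1 - χ b * z)) * (1 - z) =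
      (1 - z ^ orderOf b) ^ (q.totient / orderOf b) := by
  rw [← prod_one_sub_apply_mul, ← mul_prod_erase univ _ (mem_univ 1), mul_comm,
    filter_ne']
  simp

end DirichletCharacter

section EulerFactors

variable {q : ℕ}

theorem one_sub_zpow_neg_pos {p t : ℕ} (hp : p.Prime) (ht : t ≠ 0) :
    0 < 1 - (p : ℝ) ^ (-(t : ℤ)) := by
  rw [zpow_neg, zpow_natCast, sub_pos]
  exact inv_lt_one_of_one_lt₀ (one_lt_pow₀ (by exact_mod_cast hp.one_lt) ht)

theorem multipliable_one_sub_zpow_neg_orderOf {b : (ZMod q)ˣ} (hb : b ≠ 1) (k : ℤ) :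
    Multipliable (fun p : {p : ℕ // p.Prime ∧ ((p : ℕ) : ZMod q) = (b : ZMod q)} ↦
      (1 - ((p : ℕ) : ℝ) ^ (-(orderOf b : ℤ))) ^ k) := by
  have ht : 1 < orderOf b := by
    have h0 := orderOf_pos b
    have h1 : orderOf b ≠ 1 := orderOf_eq_one_iff.not.mpr hb
    omega
  refine Real.multipliable_of_summable_log
    (fun p ↦ zpow_pos (one_sub_zpow_neg_pos p.2.1 (by omega)) k) ?_
  simp_rw [Real.log_zpow, sub_eq_add_neg]
  refine (Real.summable_log_one_add_of_summable (Summable.neg ?_)).mul_left _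
  have h : Summable fun n : ℕ ↦ (n : ℝ) ^ (-(orderOf b : ℤ)) := by
    simpa [zpow_neg] using Real.summable_nat_pow_inv.mpr ht
  exact h.comp_injective Subtype.val_injective

theorem tendsto_prod_primesBelow_ite {P : ℕ → Prop} [DecidablePred P] {f : ℕ → ℝ}
    (hf : Multipliable fun p : {p : ℕ // p.Prime ∧ P p} ↦ f p) :
    Tendsto (fun n : ℕ ↦ ∏ p ∈ n.primesBelow, if P p then f p else 1) atTop
      (𝓝 (∏' p : {p : ℕ // p.Prime ∧ P p}, f p)) := by
  classical
  have h := (hasProd_subtype_iff_mulIndicator (s := {p : ℕ | p.Prime ∧ P p}).mp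
    hf.hasProd).tendsto_prod_nat
  refine h.congr fun n ↦ ?_
  rw [Nat.primesBelow, prod_filter]
  refine prod_congr rfl fun p _ ↦ ?_
  simp only [Set.mulIndicator_apply, Set.mem_ofPred_eq, ite_and]

open scoped Classical in
/-- The factor at `p` of the Mertens product in terms of the Euler factors at `s = 1`. -/
theorem mertens_factor_eq [NeZero q] {p : ℕ} (hp : p.Prime) :
    (((if ¬ p ∣ q then (1 - 1 / (p : ℝ)) ^
        (if (p : ZMod q) = 1 then (q.totient : ℤ) - 1 else -1) else 1 : ℝ)) : ℂ) =
      (∏ χ ∈ univ.filter (fun χ : DirichletCharacter ℂ q ↦ χ ≠ 1),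
        (1 - χ (p : ZMod q) / (p : ℂ))) *
      ((∏ b ∈ univ.filter (fun b : (ZMod q)ˣ ↦ b ≠ 1),
        if (p : ZMod q) = (b : ZMod q) then (1 - (p : ℝ) ^ (-(orderOf b : ℤ))) ^
          (-((q.totient / orderOf b : ℕ) : ℤ)) else 1 : ℝ) : ℂ) := by
  by_cases hpq : p ∣ q
  · have hnu : ¬ IsUnit (p : ZMod q) := by
      rw [ZMod.isUnit_iff_coprime, hp.coprime_iff_not_dvd]
      exact not_not.mpr hpq
    have h (b : (ZMod q)ˣ) : (p : ZMod q) ≠ b := fun h ↦ hnu (h ▸ b.isUnit)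
    simp [hpq, h, MulChar.map_nonunit _ hnu]
  · obtain ⟨u, hu⟩ := (ZMod.isUnit_iff_coprime p q).mpr (hp.coprime_iff_not_dvd.mpr hpq)
    have hp1 : (1 - 1 / (p : ℂ)) ≠ 0 := by
      have := (one_sub_zpow_neg_pos hp one_ne_zero).ne'
      simp only [Nat.cast_one, zpow_neg_one, ← one_div] at this
      simpa using Complex.ofReal_ne_zero.mpr this
    have hprod := DirichletCharacter.prod_ne_one_one_sub_apply_mul_mul u (1 / (p : ℂ))
    simp_rw [mul_one_div] at hprod
    simp only [← hu, Units.val_inj, Units.val_eq_one]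
    rw [prod_ite_eq, ← eq_div_iff hp1] at *
    rw [hprod]
    by_cases hu1 : u = 1
    · simp only [hpq, hu1, not_false_eq_true, if_true, orderOf_one]
      push_cast
      rw [zpow_sub_one₀ hp1, zpow_natCast]
      simp [div_eq_mul_inv]
    · have ht := one_sub_zpow_neg_pos hp (orderOf_pos u).ne'
      have ht' : (1 - (1 / (p : ℂ)) ^ orderOf u) ≠ 0 := by
        rw [zpow_neg, zpow_natCast, ← inv_pow, ← one_div] at ht
        simpa using Complex.ofReal_ne_zero.mpr ht.ne'
      simp only [hpq, hu1, not_false_eq_true, if_true, if_false, mem_filter, mem_univ, true_and,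
        ne_eq]
      generalize q.totient / orderOf u = k
      push_cast
      rw [zpow_neg _ (orderOf u : ℤ), zpow_natCast, ← inv_pow (p : ℂ), ← one_div (p : ℂ),
        zpow_neg _ (k : ℤ), zpow_natCast, zpow_neg_one]
      field_simp

end EulerFactors

open scoped Classical in
/-- **The constant `c(q, 1)` as a product over reduced residue classes.**
For `q ≥ 3`, the limit `c(q,1) = lim_{x→∞} ∏_{p ≤ x, p ∤ q} (1 - 1/p)^{α(p;q,1)}`
exists and equals
`Π(q,1) ∏_{b ∈ (ℤ/qℤ)ˣ, b ≠ 1} ∏_{p ≡ b (q)} (1 - p^{-t_b})^{-φ(q)/t_b}`, where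
`t_b` is the order of `b`, the inner products over primes are absolutely convergent
(multipliable), and `Π(q,1) = ∏_{χ ≠ χ₀} L(1,χ)⁻¹`. -/
theorem mertens_constant_cyclic_formula (q : ℕ) [NeZero q] (hq : 3 ≤ q) :
    ∃ c : ℝ,
      Tendsto (fun x : ℝ =>
          ∏ p ∈ (Nat.floor x + 1).primesBelow.filter (fun p => ¬ p ∣ q),
            (1 - 1 / (p : ℝ)) ^
              (if (p : ZMod q) = 1 then (q.totient : ℤ) - 1 else -1))
        atTop (𝓝 c) ∧
      (∀ b : (ZMod q)ˣ, b ≠ 1 →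
        Multipliable (fun p : {p : ℕ // p.Prime ∧ ((p : ℕ) : ZMod q) = (b : ZMod q)} =>
          (1 - ((p : ℕ) : ℝ) ^ (-(orderOf b : ℤ))) ^
            (-((q.totient / orderOf b : ℕ) : ℤ)))) ∧
      (c : ℂ) =
        (∏ χ ∈ Finset.univ.filter (fun χ : DirichletCharacter ℂ q => χ ≠ 1),
            (DirichletCharacter.LFunction χ 1)⁻¹) *
          ((∏ b ∈ Finset.univ.filter (fun b : (ZMod q)ˣ => b ≠ 1),
            ∏' p : {p : ℕ // p.Prime ∧ ((p : ℕ) : ZMod q) = (b : ZMod q)},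
              (1 - ((p : ℕ) : ℝ) ^ (-(orderOf b : ℤ))) ^
                (-((q.totient / orderOf b : ℕ) : ℤ)) : ℝ) : ℂ) := by
  have hlim : Tendsto (fun n : ℕ ↦
      ((∏ p ∈ n.primesBelow.filter (fun p ↦ ¬ p ∣ q), (1 - 1 / (p : ℝ)) ^
        (if (p : ZMod q) = 1 then (q.totient : ℤ) - 1 else -1) : ℝ) : ℂ)) atTop
      (𝓝 ((∏ χ ∈ Finset.univ.filter (fun χ : DirichletCharacter ℂ q => χ ≠ 1),
            (DirichletCharacter.LFunction χ 1)⁻¹) *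
          ((∏ b ∈ Finset.univ.filter (fun b : (ZMod q)ˣ => b ≠ 1),
            ∏' p : {p : ℕ // p.Prime ∧ ((p : ℕ) : ZMod q) = (b : ZMod q)},
              (1 - ((p : ℕ) : ℝ) ^ (-(orderOf b : ℤ))) ^
                (-((q.totient / orderOf b : ℕ) : ℤ)) : ℝ) : ℂ))) := by
    have h₁ := tendsto_finsetProd (univ.filter (fun χ : DirichletCharacter ℂ q ↦ χ ≠ 1))
      fun χ hχ ↦ DirichletCharacter.tendsto_prod_primesBelow_one_sub (mem_filter.mp hχ).2
    have h₂ := tendsto_finsetProd (univ.filter (fun b : (ZMod q)ˣ ↦ b ≠ 1))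
      fun b hb ↦ tendsto_prod_primesBelow_ite (P := fun p ↦ (p : ZMod q) = b)
        (f := fun p ↦ (1 - (p : ℝ) ^ (-(orderOf b : ℤ))) ^ (-((q.totient / orderOf b : ℕ) : ℤ)))
        (multipliable_one_sub_zpow_neg_orderOf (mem_filter.mp hb).2 _)
    refine (h₁.mul ((Complex.continuous_ofReal.tendsto _).comp h₂)).congr fun n ↦ ?_
    rw [prod_filter (fun p ↦ ¬ p ∣ q), Complex.ofReal_prod, prod_congr rfl fun p hp ↦
      mertens_factor_eq (q := q) (Nat.prime_of_mem_primesBelow hp), prod_mul_distrib,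
      ← Complex.ofReal_prod]
    exact congrArg₂ _ Finset.prod_comm (congrArg Complex.ofReal Finset.prod_comm)
  set R : ℂ := _ * _
  have hx : Tendsto (fun x : ℝ ↦ ⌊x⌋₊ + 1) atTop atTop :=
    (tendsto_add_atTop_nat 1).comp tendsto_nat_floor_atTop
  have hre : Tendsto (fun n : ℕ ↦ ∏ p ∈ n.primesBelow.filter (fun p ↦ ¬ p ∣ q),
      (1 - 1 / (p : ℝ)) ^ (if (p : ZMod q) = 1 then (q.totient : ℤ) - 1 else -1)) atTop
      (𝓝 R.re) := by
    simpa only [Function.comp_def, Complex.ofReal_re] using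
      (Complex.continuous_re.tendsto _).comp hlim
  refine ⟨R.re, hre.comp hx, fun b hb ↦ multipliable_one_sub_zpow_neg_orderOf hb _, ?_⟩
  exact tendsto_nhds_unique ((Complex.continuous_ofReal.tendsto _).comp hre) hlim
end
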